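/- For finitely generated abelian groups M and N, the natural map Hom_Ab(N, M) → Hom_{δ̂-Ring}(Z[N], Z[M]) is a bijection; that is, every ring homomorphism Z[N] → Z[M] commuting with the δ_p-structures on all p-completions (with Frobenius lifts [n]↦[pn], [m]↦[pm]) is induced by a unique group homomorphism N → M. -/

import Mathlib

/-- Multiplication by `q` as an additive monoid homomorphism. -/
def pMul (q : ℕ) (M : Type*) [AddCommGroup M] : M →+ M :=
  AddMonoidHom.mk' (fun m => q • m) (fun a b => smul_add q a b)

/-- For a prime `q`, the Frobenius lift `Σ a_m[m] ↦ Σ a_m[q•m]` on the integral group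
ring `ℤ[M]`. -/
noncomputable def frobLift (q : ℕ) (M : Type*) [AddCommGroup M] :
    AddMonoidAlgebra ℤ M →+* AddMonoidAlgebra ℤ M :=
  AddMonoidAlgebra.mapDomainRingHom ℤ (pMul q M)

open AddMonoidAlgebra

/-- In a group ring over a group with two unique sums, every unit is a monomial. -/
theorem exists_eq_single_of_mul_eq_one {R Q : Type*} [Semiring R] [NoZeroDivisors R]
    [Nontrivial R] [AddMonoid Q] [TwoUniqueSums Q] {x y : AddMonoidAlgebra R Q} (h : x * y = 1) :
    ∃ q c, x = single q c := by
  classical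
  have hx : x ≠ 0 := fun hx => by simp [hx] at h
  have hy : y ≠ 0 := fun hy => by simp [hy] at h
  have hx' : 0 < x.coeff.support.card := by simpa [Finset.card_pos] using hx
  have hy' : 0 < y.coeff.support.card := by simpa [Finset.card_pos] using hy
  have hcard : x.coeff.support.card ≤ 1 := by
    by_contra! hlt
    obtain ⟨p, hp, r, hr, hne, hpu, hru⟩ :=
      TwoUniqueSums.uniqueAdd_of_one_lt_card (hlt.trans_le (Nat.le_mul_of_pos_right _ hy'))
    have key : ∀ s ∈ x.coeff.support ×ˢ y.coeff.support,
        UniqueAdd x.coeff.support y.coeff.support s.1 s.2 → s.1 + s.2 = 0 := by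
      intro s hs hsu
      have h1 := coeff_mul_add_of_uniqueAdd hsu
      rw [Finset.mem_product, Finsupp.mem_support_iff, Finsupp.mem_support_iff] at hs
      by_contra h0
      rw [h, one_def, coeff_single, Finsupp.single_eq_of_ne h0] at h1
      exact mul_ne_zero hs.1 hs.2 h1.symm
    have hr' := Finset.mem_product.mp hr
    obtain ⟨h1, h2⟩ := hpu hr'.1 hr'.2 ((key r hr hru).trans (key p hp hpu).symm)
    exact hne (Prod.ext h1.symm h2.symm)
  obtain ⟨q, c, -, hq⟩ := Finsupp.card_support_eq_one'.mp (le_antisymm hcard hx')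
  exact ⟨q, c, by rw [← coeff_inj, hq, coeff_single]⟩

theorem exists_pos_nsmul_eq_zero_of_mem_torsion {M : Type*} [AddCommGroup M] [AddGroup.FG M] :
    ∃ e : ℕ, 0 < e ∧ ∀ m ∈ AddCommGroup.torsion M, e • m = 0 := by
  have : Module.Finite ℤ M := Module.Finite.iff_addGroup_fg.mpr inferInstance
  have : Module.Finite ℤ (AddCommGroup.torsion M) :=
    inferInstanceAs (Module.Finite ℤ (AddSubgroup.toIntSubmodule (AddCommGroup.torsion M)))
  have : AddGroup.FG (AddCommGroup.torsion M) := Module.Finite.iff_addGroup_fg.mp inferInstance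
  have : Finite (AddCommGroup.torsion M) := by
    refine AddCommGroup.finite_of_fg_isAddTorsion _ fun t => ?_
    exact AddSubmonoid.isOfFinAddOrder_coe.mp t.2
  refine ⟨Nat.card (AddCommGroup.torsion M), Nat.card_pos, fun m hm => ?_⟩
  exact congrArg Subtype.val (card_nsmul_eq_zero' (x := (⟨m, hm⟩ : AddCommGroup.torsion M)))

/-- A nonzero monomial whose square is its image under `[m] ↦ [2 • m]` has coefficient one. -/
theorem coeff_eq_one_of_sq_eq_frobLift {Q : Type*} [AddCommGroup Q] {q : Q} {c : ℤ}
    (hc : c ≠ 0) (h : (single q c : AddMonoidAlgebra ℤ Q) ^ 2 = frobLift 2 Q (single q c)) :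
    c = 1 := by
  have h' : (single (2 • q) (c ^ 2) : AddMonoidAlgebra ℤ Q) = single (2 • q) c := by
    simpa [frobLift, pMul, single_pow] using h
  have := single_right_injective h'
  exact mul_left_cancel₀ hc (by linarith [sq c])

theorem frobLift_single (n : ℕ) {M : Type*} [AddCommGroup M] (m : M) (c : ℤ) :
    frobLift n M (single m c) = single (n • m) c := by
  simp [frobLift, pMul]

theorem frobLift_mapDomainRingHom (n : ℕ) {M N : Type*} [AddCommGroup M] [AddCommGroup N]
    (g : N →+ M) (x : AddMonoidAlgebra ℤ N) :
    frobLift n M (mapDomainRingHom ℤ g x) = mapDomainRingHom ℤ g (frobLift n N x) := by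
  simp only [frobLift, ← RingHom.comp_apply, ← mapDomainRingHom_comp]
  congr 2
  ext m
  simp [pMul]

theorem frobLift_mul_apply (a b : ℕ) {M : Type*} [AddCommGroup M] (x : AddMonoidAlgebra ℤ M) :
    frobLift (a * b) M x = frobLift a M (frobLift b M x) := by
  simp only [frobLift, ← RingHom.comp_apply, ← mapDomainRingHom_comp]
  congr 2
  ext m
  simp [pMul, mul_smul]

theorem frobLift_one_apply {M : Type*} [AddCommGroup M] (x : AddMonoidAlgebra ℤ M) :
    frobLift 1 M x = x := by
  have : pMul 1 M = AddMonoidHom.id M := by ext m; simp [pMul]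
  simp [frobLift, this]

theorem pow_eq_frobLift_of_prime {M : Type*} [AddCommGroup M] {x : AddMonoidAlgebra ℤ M}
    (h : ∀ q : ℕ, q.Prime → x ^ q = frobLift q M x) {n : ℕ} (hn : n ≠ 0) :
    x ^ n = frobLift n M x := by
  induction n using Nat.recOnMul with
  | zero => exact absurd rfl hn
  | one => rw [pow_one, frobLift_one_apply]
  | prime p hp => exact h p hp
  | mul a b ha hb =>
    rw [mul_ne_zero_iff] at hn
    rw [mul_comm a b, pow_mul, hb hn.2, ← map_pow, ha hn.1, frobLift_mul_apply]

/-- If the support is finite and `y` is invariant under multiplication by all `k * e + 1`,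
then `y` is supported on torsion elements. -/
theorem support_subset_torsion {M : Type*} [AddCommGroup M] {y : AddMonoidAlgebra ℤ M} {e : ℕ}
    (he : 0 < e) (h : ∀ k, frobLift (k * e + 1) M y = y) {s : M} (hs : s ∈ y.coeff.support) :
    s ∈ AddCommGroup.torsion M := by
  classical
  have hk : ∀ k : ℕ, ∃ t : y.coeff.support, (k * e + 1) • (t : M) = s := by
    intro k
    have hs' := hs
    rw [← h k] at hs'
    obtain ⟨t, ht, hts⟩ := Finset.mem_image.mp (Finsupp.mapDomain_support hs')
    exact ⟨⟨t, ht⟩, hts⟩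
  choose t ht using hk
  obtain ⟨a, b, hab, htab⟩ := Finite.exists_ne_map_eq_of_infinite t
  have htor : (t a : M) ∈ AddCommGroup.torsion M := by
    have h1 : ((a * e + 1 : ℕ) : ℤ) • (t a : M) = ((b * e + 1 : ℕ) : ℤ) • (t a : M) := by
      rw [natCast_zsmul, natCast_zsmul, ht a, htab, ht b]
    rw [← sub_eq_zero, ← sub_smul] at h1
    rw [AddCommGroup.mem_torsion, isOfFinAddOrder_iff_zsmul_eq_zero]
    refine ⟨_, ?_, h1⟩
    push_cast
    rw [add_sub_add_right_eq_sub, ← sub_mul]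
    refine mul_ne_zero (sub_ne_zero.mpr (by exact_mod_cast hab)) (by exact_mod_cast he.ne')
  rw [← ht a]
  exact AddSubgroup.nsmul_mem _ htor _

/-- An element of an integral group ring inverse to its image under `[m] ↦ [-m]` is a monomial. -/
theorem exists_eq_single_of_mul_mapDomain_neg {M : Type*} [AddCommGroup M]
    {y : AddMonoidAlgebra ℤ M} (h : y * mapDomain (fun m => -m) y = 1) :
    ∃ m c, y = single m c := by
  have hsum : ∑ m ∈ y.coeff.support, y.coeff m * y.coeff m = 1 := by
    have h0 := congrArg (fun z => z.coeff 0) h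
    simp only [coeff_mul_apply_left, add_zero, one_def, coeff_single, Finsupp.single_eq_same,
      Finsupp.sum] at h0
    rw [← h0]
    refine Finset.sum_congr rfl fun m _ => ?_
    rw [coeff_mapDomain, Finsupp.mapDomain_apply neg_injective]
  have hcard : (y.coeff.support.card : ℤ) ≤ 1 := by
    rw [← hsum, Finset.cast_card]
    refine Finset.sum_le_sum fun m hm => ?_
    exact Int.add_one_le_iff.mpr (mul_self_pos.mpr (Finsupp.mem_support_iff.mp hm))
  obtain ⟨m, c, hmc⟩ := Finsupp.card_support_le_one'.mp (by exact_mod_cast hcard)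
  exact ⟨m, c, by rw [← coeff_inj, hmc, coeff_single]⟩

/-- A unit of `ℤ[M]` satisfying `x ^ n = ψ_n x` for all `n ≠ 0` is a group element. -/
theorem exists_eq_single_one_of_pow_eq_frobLift {M : Type*} [AddCommGroup M] [AddGroup.FG M]
    {x x' : AddMonoidAlgebra ℤ M} (hu : x * x' = 1)
    (h : ∀ n : ℕ, n ≠ 0 → x ^ n = frobLift n M x) : ∃ m, x = single m 1 := by
  have : AddMonoid.FG (M ⧸ AddCommGroup.torsion M) :=
    AddGroup.fg_iff_addMonoid_fg.mp inferInstance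
  set mk := QuotientAddGroup.mk' (AddCommGroup.torsion M) with hmk
  obtain ⟨e, he, het⟩ := exists_pos_nsmul_eq_zero_of_mem_torsion (M := M)
  obtain ⟨q, c, hqc⟩ := exists_eq_single_of_mul_eq_one
    (x := mapDomainRingHom ℤ mk x) (y := mapDomainRingHom ℤ mk x') (by rw [← map_mul, hu, map_one])
  have hc : c ≠ 0 := by
    rintro rfl
    have := congrArg (mapDomainRingHom ℤ mk) hu
    rw [map_mul, hqc, single_zero, zero_mul, map_one] at this
    exact zero_ne_one this
  obtain rfl : c = 1 := by
    refine coeff_eq_one_of_sq_eq_frobLift hc (q := q) ?_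
    rw [← hqc, ← map_pow, h 2 two_ne_zero, frobLift_mapDomainRingHom]
  obtain ⟨m, rfl⟩ := QuotientAddGroup.mk'_surjective _ q
  set y := x * single (-m) 1 with hy
  have hxy : x = y * single m 1 := by
    rw [hy, mul_assoc, single_mul_single, neg_add_cancel, one_mul, ← one_def, mul_one]
  have hyn : ∀ n : ℕ, n ≠ 0 → y ^ n = frobLift n M y := by
    intro n hn
    rw [hy, mul_pow, h n hn, map_mul, frobLift_single, single_pow, one_pow]
  have hy1 : mapDomainRingHom ℤ mk y = 1 := by
    rw [hy, map_mul, hqc, mapDomainRingHom_apply, mapDomain_single, single_mul_single, ← map_add,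
      add_neg_cancel, map_zero, one_mul, one_def]
  have hye : y ^ e = 1 := by
    have hle : AddCommGroup.torsion M ≤ (pMul e M).ker := fun t ht => het t ht
    have : pMul e M = (QuotientAddGroup.lift _ (pMul e M) hle).comp mk := by
      ext t; rfl
    rw [hyn e he.ne', frobLift, this, mapDomainRingHom_comp, RingHom.comp_apply, hy1, map_one]
  have hsupp : ∀ s ∈ y.coeff.support, s ∈ AddCommGroup.torsion M := fun s hs =>
    support_subset_torsion he (fun k => by
      rw [← hyn _ (Nat.succ_ne_zero _), pow_succ, mul_comm k, pow_mul, hye, one_pow, one_mul]) hs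
  have hneg : frobLift (2 * e - 1) M y = mapDomain (fun m => -m) y := by
    rw [frobLift, mapDomainRingHom_apply, ← coeff_inj, coeff_mapDomain, coeff_mapDomain]
    refine Finsupp.mapDomain_congr fun s hs => ?_
    have h2 : (2 * e - 1) • s + s = 0 := by
      rw [← succ_nsmul, Nat.sub_add_cancel (by omega), mul_smul, het s (hsupp s hs), smul_zero]
    exact eq_neg_of_add_eq_zero_left h2
  obtain ⟨t, d, htd⟩ := exists_eq_single_of_mul_mapDomain_neg (y := y) (by
    rw [← hneg, ← hyn _ (by omega), ← pow_succ', Nat.sub_add_cancel (by omega), mul_comm, pow_mul,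
      hye, one_pow])
  have hd : d ≠ 0 := by
    rintro rfl
    rw [htd, single_zero, map_zero] at hy1
    exact zero_ne_one hy1
  obtain rfl : d = 1 := coeff_eq_one_of_sq_eq_frobLift hd (by rw [← htd, hyn 2 two_ne_zero])
  exact ⟨t + m, by rw [hxy, htd, single_mul_single, one_mul]⟩

/-- For finitely generated abelian groups `M`, `N`, the natural map
`Hom_Ab(N, M) → Hom_{δ̂-Ring}(ℤ[N], ℤ[M])` is a bijection: every group homomorphism
induces a ring homomorphism commuting with all the Frobenius lifts `[x] ↦ [q•x]`
(equivalently, with the δ_q-structures on all q-completions), and conversely every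
such ring homomorphism is induced by a unique group homomorphism `N → M`. -/
theorem groupRing_deltaHat_fully_faithful
    {M : Type*} [AddCommGroup M] (hM : AddGroup.FG M)
    {N : Type*} [AddCommGroup N] (hN : AddGroup.FG N) :
    (∀ (g : N →+ M) (q : ℕ), q.Prime →
      (AddMonoidAlgebra.mapDomainRingHom ℤ g).comp (frobLift q N) =
        (frobLift q M).comp (AddMonoidAlgebra.mapDomainRingHom ℤ g)) ∧
    (∀ F : AddMonoidAlgebra ℤ N →+* AddMonoidAlgebra ℤ M,
      (∀ q : ℕ, q.Prime → F.comp (frobLift q N) = (frobLift q M).comp F) →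
      ∃! g : N →+ M, F = AddMonoidAlgebra.mapDomainRingHom ℤ g) := by
  refine ⟨fun g q _ => RingHom.ext fun x => (frobLift_mapDomainRingHom q g x).symm,
    fun F hF => ?_⟩
  have hmul : ∀ a b : N, (single (a + b) 1 : AddMonoidAlgebra ℤ N) = single a 1 * single b 1 :=
    fun a b => by rw [single_mul_single, one_mul]
  have hex : ∀ n : N, ∃ m : M, F (single n 1) = single m 1 := by
    intro n
    refine exists_eq_single_one_of_pow_eq_frobLift (x' := F (single (-n) 1)) ?_ fun k hk =>
      pow_eq_frobLift_of_prime (fun q hq => ?_) hk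
    · rw [← map_mul, ← hmul, add_neg_cancel, ← one_def, map_one]
    · have := RingHom.congr_fun (hF q hq) (single n 1)
      rw [RingHom.comp_apply, RingHom.comp_apply, frobLift_single] at this
      rw [← this, ← map_pow, single_pow, one_pow]
  choose g hg using hex
  have hadd : ∀ a b, g (a + b) = g a + g b := by
    intro a b
    refine single_left_injective (R := ℤ) one_ne_zero ?_
    simp only
    rw [← hg, hmul, map_mul, hg, hg, single_mul_single, one_mul]
  refine ⟨AddMonoidHom.mk' g hadd, ?_, fun g' hg' => ?_⟩
  · refine ringHom_ext (fun r => ?_) fun n => ?_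
    · have hr : (single 0 r : AddMonoidAlgebra ℤ N) = (r : AddMonoidAlgebra ℤ N) := rfl
      rw [hr, map_intCast, map_intCast]
    · rw [hg, mapDomainRingHom_apply, mapDomain_single]
      rfl
  · ext n
    refine single_left_injective (R := ℤ) one_ne_zero ?_
    have := hg n
    rw [hg', mapDomainRingHom_apply, mapDomain_single] at this
    exact this
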